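/- Let q be an odd prime power, r ≥ 2 an even integer, a ∈ F\{0} and b ∈ F with b^q ≠ b, where F = GF(q²), and suppose 4a^{q+1} + (b^q − b)² = 0. Then B(a,b) has exactly q^{2r−1} points and for every affine hyperplane π of F^r the cardinality |π ∩ B(a,b)| belongs to the set { q^{2r−3} − q^{(3r−4)/2}, q^{2r−3}, q^{2r−3} + q^{(3r−4)/2} }. -/

import Mathlib

open Finset

/-- The affine point set `B(a,b) ⊆ AG(r,q²)`: a point of `F^r` is encoded as a pair
consisting of its first `r - 1` coordinates `(x₁, …, x_{r-1})` together with its last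
coordinate `x_r`.  It consists of the solutions of
`x_r^q − x_r + a^q(x₁^{2q}+⋯+x_{r−1}^{2q}) − a(x₁²+⋯+x_{r−1}²)
  = (b^q − b)(x₁^{q+1}+⋯+x_{r−1}^{q+1})`. -/
def BSet (q r : ℕ) {F : Type*} [Field F] (a b : F) :
    Set ((Fin (r - 1) → F) × F) :=
  {x | x.2 ^ q - x.2 + a ^ q * (∑ i, x.1 i ^ (2 * q)) - a * (∑ i, x.1 i ^ 2)
      = (b ^ q - b) * ∑ i, x.1 i ^ (q + 1)}


theorem shift_count {X A : Type*} [Fintype X] [Fintype A] [AddCommGroup A]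
    (g : X → A) (T : A → X → X) (hT : ∀ t, Function.Injective (T t))
    (hg : ∀ t x, g (T t x) = g x + t) (s : A) :
    {x | g x = s}.ncard * Fintype.card A = Fintype.card X := by
  classical
  have h1 : ∀ s s', {x | g x = s}.ncard ≤ {x | g x = s'}.ncard := by
    intro s s'
    apply Set.ncard_le_ncard_of_injOn (T (s' - s))
    · intro x hx
      simp only [Set.mem_ofPred_eq] at hx ⊢
      rw [hg, hx]; abel
    · exact (hT _).injOn
  have h2 : ∀ s', #{x | g x = s'} = {x | g x = s}.ncard := by
    intro s'
    rw [le_antisymm (h1 s s') (h1 s' s), Set.ncard_eq_toFinset_card']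
    simp
  have h3 := Finset.card_eq_sum_card_fiberwise (f := g) (s := (univ : Finset X)) (t := univ) (by simp)
  rw [Finset.card_univ] at h3
  rw [h3, Finset.sum_congr rfl (fun s' _ => h2 s')]
  simp [mul_comm]

section
variable {K : Type*} [Field K] [Fintype K] [DecidableEq K]

def sqN (K : Type*) [Field K] [Fintype K] [DecidableEq K] (n : ℕ) (c : K) : ℤ :=
  ∑ u : Fin n → K, if ∑ i, u i ^ 2 = c then 1 else 0

theorem sqN_succ (n : ℕ) (c : K) : sqN K (n+1) c = ∑ x : K, sqN K n (c - x ^ 2) := by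
  unfold sqN
  rw [← Fintype.sum_equiv (Fin.consEquiv (fun _ : Fin (n+1) => K)) (fun p => 
    if p.1 ^ 2 + ∑ i, p.2 i ^ 2 = c then (1:ℤ) else 0) _ ?_]
  · rw [Fintype.sum_prod_type]
    refine Finset.sum_congr rfl fun x _ => Finset.sum_congr rfl fun v _ => ?_
    congr 1
    rw [eq_sub_iff_add_eq']
  · rintro ⟨x, v⟩
    simp [Fin.sum_univ_succ, Fin.consEquiv]

theorem sum_sq (hK : ringChar K ≠ 2) (f : K → ℤ) :
    ∑ x : K, f (x ^ 2) = ∑ s : K, (quadraticChar K s + 1) * f s := by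
  rw [← Finset.sum_fiberwise_of_maps_to (s := univ) (t := univ) (g := fun x : K => x ^ 2) (by simp)]
  refine Finset.sum_congr rfl fun s _ => ?_
  rw [Finset.sum_congr rfl (g := fun _ => f s)]
  · rw [Finset.sum_const, ← quadraticChar_card_sqrts hK s]
    simp
  · intro x hx
    simp at hx
    rw [hx]

theorem qc_conv (hK : ringChar K ≠ 2) (c : K) :
    ∑ s : K, quadraticChar K s * quadraticChar K (c - s) =
      quadraticChar K (-1) * ((if c = 0 then (Fintype.card K : ℤ) else 0) - 1) := by
  have hsq : ∀ x : K, x ≠ 0 → quadraticChar K x * quadraticChar K x = 1 := by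
    intro x hx
    rw [← sq, quadraticChar_sq_one hx]
  by_cases hc : c = 0
  · subst hc
    have : ∀ s : K, quadraticChar K s * quadraticChar K (0 - s) = quadraticChar K (-1) * (1 - if s = 0 then 1 else 0) := by
      intro s
      by_cases hs : s = 0
      · simp [hs]
      · rw [zero_sub, ← neg_one_mul s, map_mul]
        have := hsq s hs
        simp only [hs, if_false]
        linear_combination quadraticChar K (-1) * this
    simp_rw [this]
    rw [← Finset.mul_sum]
    simp
  · have hj := jacobiSum_nontrivial_inv (quadraticChar_ne_one hK)
    rw [(quadraticChar_isQuadratic K).inv, jacobiSum] at hj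
    rw [← Fintype.sum_equiv (Equiv.mulLeft₀ c hc) (fun t => quadraticChar K t * quadraticChar K (1 - t)), hj]
    · simp [hc]
    · intro t
      have := hsq c hc
      have h2 : c - c * t = c * (1 - t) := by ring
      simp only [Equiv.mulLeft₀_apply, h2, map_mul]
      linear_combination -(quadraticChar K t * quadraticChar K (1 - t)) * this

theorem sum_shift {K : Type*} [Field K] [Fintype K] (f : K → ℤ) (c : K) : ∑ s : K, f (c - s) = ∑ s, f s :=
  Fintype.sum_equiv (Equiv.subLeft c) _ _ (fun _ => rfl)

theorem sqN_odd (hK : ringChar K ≠ 2) (k : ℕ) : ∀ (c : K), sqN K (2 * k + 1) c =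
    (Fintype.card K : ℤ) ^ (2 * k) + quadraticChar K (-1) ^ k * (Fintype.card K : ℤ) ^ k * quadraticChar K c := by
  induction k with
  | zero =>
    intro c
    rw [sqN_succ]
    have : ∀ x : K, sqN K (2 * 0) (c - x ^ 2) = (fun s => if s = c then (1:ℤ) else 0) (x ^ 2) := by
      intro x
      simp only [sqN]
      simp [eq_comm (a := (0:K)), sub_eq_zero, eq_comm (a := c)]
    rw [Finset.sum_congr rfl (fun x _ => this x), sum_sq hK (fun s => if s = c then (1:ℤ) else 0)]
    simp [add_comm]
  | succ k ih =>
    intro c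
    have hev : ∀ c, sqN K (2 * k + 1 + 1) c = (Fintype.card K : ℤ) ^ (2 * k + 1) + 
      quadraticChar K (-1) ^ (k + 1) * (Fintype.card K : ℤ) ^ k * ((if c = 0 then (Fintype.card K : ℤ) else 0) - 1) := by
      intro c
      rw [sqN_succ]
      rw [sum_sq hK (fun s => sqN K (2*k+1) (c - s))]
      have h1 := qc_conv hK c
      have h2 := quadraticChar_sum_zero hK
      have h3 := sum_shift (fun s => quadraticChar K s) c
      simp only [ih]
      have : ∀ s : K, (quadraticChar K s + 1) * ((Fintype.card K : ℤ) ^ (2 * k) + quadraticChar K (-1) ^ k * (Fintype.card K : ℤ) ^ k * quadraticChar K (c - s))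
        = (Fintype.card K : ℤ) ^ (2 * k) * quadraticChar K s + (Fintype.card K : ℤ) ^ (2 * k) + 
         quadraticChar K (-1) ^ k * (Fintype.card K : ℤ) ^ k * (quadraticChar K s * quadraticChar K (c - s)) + quadraticChar K (-1) ^ k * (Fintype.card K : ℤ) ^ k * quadraticChar K (c - s) := by
        intro s; ring
      rw [Finset.sum_congr rfl (fun s _ => this s)]
      simp only [Finset.sum_add_distrib, ← Finset.mul_sum]
      rw [h1, h2, h3, h2]
      simp
      ring
    have e : 2 * (k + 1) + 1 = (2 * k + 1 + 1) + 1 := by ring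
    rw [e, sqN_succ, sum_sq hK (fun s => sqN K (2*k+1+1) (c - s))]
    simp only [hev]
    have h2 := quadraticChar_sum_zero hK
    have : ∀ s : K, (quadraticChar K s + 1) * ((Fintype.card K : ℤ) ^ (2 * k + 1) + 
      quadraticChar K (-1) ^ (k + 1) * (Fintype.card K : ℤ) ^ k * ((if c - s = 0 then (Fintype.card K : ℤ) else 0) - 1))
      = ((Fintype.card K : ℤ) ^ (2 * k + 1) - quadraticChar K (-1) ^ (k + 1) * (Fintype.card K : ℤ) ^ k) * quadraticChar K s
       + ((Fintype.card K : ℤ) ^ (2 * k + 1) - quadraticChar K (-1) ^ (k + 1) * (Fintype.card K : ℤ) ^ k)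
       + quadraticChar K (-1) ^ (k + 1) * (Fintype.card K : ℤ) ^ k * (if c = s then (quadraticChar K s + 1) * (Fintype.card K : ℤ) else 0) := by
      intro s
      simp only [sub_eq_zero]
      split_ifs <;> ring
    rw [Finset.sum_congr rfl (fun s _ => this s)]
    simp only [Finset.sum_add_distrib, ← Finset.mul_sum]
    rw [h2]
    simp
    ring
end

section
variable {K F : Type*} [Field K] [Fintype K] [Fintype F]

theorem sqN_eq_ncard [DecidableEq K] (n : ℕ) (c : K) :
    sqN K n c = ({u : Fin n → K | ∑ i, u i ^ 2 = c}.ncard : ℤ) := by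
  rw [Set.ncard_eq_toFinset_card', sqN]
  simp

theorem core_count [AddCommGroup F] [Module K F] (hK : ringChar K ≠ 2)
    (hcard : Fintype.card F = Fintype.card K ^ 2) (l : F →ₗ[K] K) (p : F) (hp : l p = 1)
    (n k : ℕ) (hn : n = 2 * k + 1) (m : Fin n → F →ₗ[K] K) (d : K) :
    {x : Fin n → F | ∑ i, l (x i) ^ 2 = d + ∑ i, m i (x i)}.ncard ∈
      ({Fintype.card K ^ (4 * k + 1) - Fintype.card K ^ (3 * k + 1), Fintype.card K ^ (4 * k + 1),
        Fintype.card K ^ (4 * k + 1) + Fintype.card K ^ (3 * k + 1)} : Set ℕ) := by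
  classical
  have hpos : 0 < Fintype.card K := Fintype.card_pos
  have h2 : (2 : K) ≠ 0 := Ring.two_ne_zero hK
  by_cases hm : ∀ i y, l y = 0 → m i y = 0
  · -- all `m i` are multiples of `l`
    have hm' : ∀ i y, m i y = m i p * l y := by
      intro i y
      have := hm i (y - l y • p) (by simp [hp])
      rw [map_sub, map_smul, smul_eq_mul, sub_eq_zero] at this
      rw [this, mul_comm]
    have hfib : ∀ u : Fin n → K, #{x : Fin n → F | (fun i => l (x i)) = u} = Fintype.card K ^ n := by
      intro u
      have := shift_count (X := Fin n → F) (A := Fin n → K) (fun x i => l (x i))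
        (fun t x i => x i + t i • p) (fun t x y h => by
          funext i
          have := congrFun h i
          simpa using this) (fun t x => by funext i; simp [hp]) u
      rw [Set.ncard_eq_toFinset_card'] at this
      simp only [Fintype.card_pi, Finset.prod_const, Finset.card_univ, Fintype.card_fin, hcard] at this
      have h3 : 0 < Fintype.card K ^ n := by positivity
      apply Nat.eq_of_mul_eq_mul_right h3
      rw [← mul_pow, ← sq, ← this]
      simp
    set c : K := d + ∑ i, (m i p / 2) ^ 2 with hc
    have e1 : {x : Fin n → F | ∑ i, l (x i) ^ 2 = d + ∑ i, m i (x i)}.ncard =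
        {u : Fin n → K | ∑ i, u i ^ 2 = c}.ncard * Fintype.card K ^ n := by
      have e2 : {u : Fin n → K | ∑ i, u i ^ 2 = c}.ncard =
          {u : Fin n → K | ∑ i, u i ^ 2 = d + ∑ i, m i p * u i}.ncard := by
        apply Set.ncard_congr (fun u _ => u + fun i => m i p / 2)
        · intro u hu
          simp only [Set.mem_ofPred_eq, hc] at hu ⊢
          have : ∀ i, (u + fun i => m i p / 2) i ^ 2 = u i ^ 2 + (m i p * (u + fun i => m i p / 2) i - (m i p / 2) ^ 2) := by
            intro i
            simp only [Pi.add_apply]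
            field_simp
            ring
          rw [Finset.sum_congr rfl (fun i _ => this i), Finset.sum_add_distrib, Finset.sum_sub_distrib, hu]
          ring
        · intro u v _ _ h
          exact add_right_cancel h
        · intro v hv
          simp only [Set.mem_ofPred_eq, hc] at hv ⊢
          refine ⟨v - fun i => m i p / 2, ?_, by simp⟩
          have : ∀ i, (v - fun i => m i p / 2) i ^ 2 = v i ^ 2 - (m i p * v i) + (m i p / 2) ^ 2 := by
            intro i
            simp only [Pi.sub_apply]
            field_simp
            ring
          rw [Finset.sum_congr rfl (fun i _ => this i), Finset.sum_add_distrib, Finset.sum_sub_distrib, hv]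
          ring
      rw [e2, Set.ncard_eq_toFinset_card', Set.ncard_eq_toFinset_card']
      rw [Finset.card_eq_sum_card_fiberwise (f := fun x i => l (x i))
        (t := {u : Fin n → K | ∑ i, u i ^ 2 = d + ∑ i, m i p * u i}.toFinset)]
      · rw [Finset.sum_congr rfl (g := fun _ => Fintype.card K ^ n)]
        · simp
        · intro u hu
          rw [← hfib u]
          congr 1
          ext x
          simp only [Set.mem_toFinset, Set.mem_ofPred_eq, Finset.mem_filter, Finset.mem_univ, true_and] at hu ⊢
          constructor
          · exact fun h => h.2
          · intro h
            refine ⟨?_, h⟩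
            subst h
            rw [hu]
            simp only [← hm']
      · intro x hx
        simp only [Set.mem_toFinset, Set.mem_ofPred_eq, Set.coe_toFinset] at hx ⊢
        rw [hx]
        simp only [← hm']
    rw [e1]
    have hN := sqN_odd hK k c
    rw [← hn, sqN_eq_ncard] at hN
    generalize {u : Fin n → K | ∑ i, u i ^ 2 = c}.ncard = N at hN ⊢
    generalize Fintype.card K = Q at hN hpos ⊢
    have hle : Q ^ (3 * k + 1) ≤ Q ^ (4 * k + 1) := Nat.pow_le_pow_right hpos (by omega)
    simp only [Set.mem_insert_iff, Set.mem_singleton_iff]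
    have hχ : quadraticChar K (-1) ^ k = 1 ∨ quadraticChar K (-1) ^ k = -1 := by
      rcases quadraticChar_dichotomy (neg_ne_zero.mpr (one_ne_zero (α := K))) with h | h <;> rw [h]
      · simp
      · exact neg_one_pow_eq_or ℤ k
    have key : quadraticChar K (-1) ^ k * quadraticChar K c = 0 ∨ quadraticChar K (-1) ^ k * quadraticChar K c = 1 ∨
        quadraticChar K (-1) ^ k * quadraticChar K c = -1 := by
      rcases hχ with h | h <;> rcases quadraticChar_isQuadratic K c with h' | h' | h' <;> rw [h, h'] <;> norm_num
    have hN' : (N : ℤ) * Q ^ n = Q ^ (4 * k + 1) + (quadraticChar K (-1) ^ k * quadraticChar K c) * Q ^ (3 * k + 1) := by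
      rw [hN, hn]; ring
    rcases key with h | h | h <;> rw [h] at hN'
    · right; left
      zify; linarith
    · right; right
      zify; linarith
    · left
      zify [hle]; linarith
  · push Not at hm
    obtain ⟨i, y, hy, hmy⟩ := hm
    right; left
    have := shift_count (X := Fin n → F) (A := K) (fun x => d + ∑ i, m i (x i) - ∑ i, l (x i) ^ 2)
      (fun t x => x + Pi.single i ((t / m i y) • y)) (fun t x x' h => add_right_cancel h) (fun t x => by
        have h1 : ∀ j, l ((x + Pi.single i ((t / m i y) • y) : Fin n → F) j) = l (x j) := by
          intro j
          by_cases hj : j = i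
          · subst hj; simp [hy]
          · simp [hj]
        have h2 : ∀ j, m j ((x + Pi.single i ((t / m i y) • y) : Fin n → F) j) = m j (x j) + if j = i then t else 0 := by
          intro j
          by_cases hj : j = i
          · subst hj; simp [hmy]
          · simp [hj]
        simp only [h1, h2, Finset.sum_add_distrib]
        simp
        ring) 0
    simp only [sub_eq_zero, Fintype.card_pi, Finset.prod_const, Finset.card_univ, Fintype.card_fin, hcard] at this
    have h3 : {x : Fin n → F | ∑ i, l (x i) ^ 2 = d + ∑ i, m i (x i)} = {x : Fin n → F | d + ∑ i, m i (x i) = ∑ i, l (x i) ^ 2} := by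
      ext x; exact eq_comm
    rw [h3]
    apply Nat.eq_of_mul_eq_mul_right hpos
    rw [this, hn]; ring

theorem abs_count [Field F] [Algebra K F] (hK : ringChar K ≠ 2)
    (hcard : Fintype.card F = Fintype.card K ^ 2) (l D : F →ₗ[K] K) (p : F) (hp : l p = 1)
    (p' : F) (hp' : D p' = 1)
    (n k : ℕ) (hn : n = 2 * k + 1) :
    {x : (Fin n → F) × F | D x.2 = ∑ i, l (x.1 i) ^ 2}.ncard = Fintype.card K ^ (4 * k + 3) ∧
    ∀ (c : Fin n → F) (c0 d : F), ¬(c = 0 ∧ c0 = 0) →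
      ({x : (Fin n → F) × F | (∑ i, c i * x.1 i) + c0 * x.2 = d} ∩
        {x : (Fin n → F) × F | D x.2 = ∑ i, l (x.1 i) ^ 2}).ncard ∈
      ({Fintype.card K ^ (4 * k + 1) - Fintype.card K ^ (3 * k + 1), Fintype.card K ^ (4 * k + 1),
        Fintype.card K ^ (4 * k + 1) + Fintype.card K ^ (3 * k + 1)} : Set ℕ) := by
  classical
  have hpos : 0 < Fintype.card K := Fintype.card_pos
  constructor
  · have := shift_count (X := (Fin n → F) × F) (A := K) (fun x => D x.2 - ∑ i, l (x.1 i) ^ 2)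
      (fun t x => (x.1, x.2 + t • p')) (fun t x x' h => by
        simp only [Prod.mk.injEq, add_left_inj] at h
        exact Prod.ext h.1 h.2) (fun t x => by simp [hp']; ring) 0
    simp only [sub_eq_zero, Fintype.card_prod, Fintype.card_pi, Finset.prod_const, Finset.card_univ, Fintype.card_fin, hcard] at this
    apply Nat.eq_of_mul_eq_mul_right hpos
    rw [this, hn]; ring
  · intro c c0 d hc
    by_cases h0 : c0 = 0
    · subst h0
      have hc' : ∃ i, c i ≠ 0 := by
        by_contra! h
        exact hc ⟨funext h, rfl⟩
      obtain ⟨i, hi⟩ := hc'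
      right; left
      have := shift_count (X := (Fin n → F) × F) (A := F × K) (fun x => (∑ i, c i * x.1 i, D x.2 - ∑ i, l (x.1 i) ^ 2))
        (fun t x => (x.1 + Pi.single i (t.1 / c i), x.2 + (t.2 + (∑ j, l ((x.1 + Pi.single i (t.1 / c i) : Fin n → F) j) ^ 2) - ∑ j, l (x.1 j) ^ 2) • p')) (fun t x x' h => by
          simp only [Prod.mk.injEq, add_left_inj] at h
          have h1 := h.1
          have h2 := h.2
          rw [h1] at h2
          exact Prod.ext h1 (add_right_cancel h2)) (fun t x => by
            ext
            · simp only [Pi.add_apply, mul_add, Finset.sum_add_distrib, Prod.fst_add]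
              congr 1
              rw [Finset.sum_eq_single i]
              · simp; field_simp
              · intro j _ hj; simp [hj]
              · simp
            · simp only [map_add, map_smul, hp', smul_eq_mul, Prod.snd_add]
              ring) (d, 0)
      simp only [Prod.mk.injEq, sub_eq_zero, Fintype.card_prod, Fintype.card_pi, Finset.prod_const, Finset.card_univ, Fintype.card_fin, hcard] at this
      have h3 : 0 < Fintype.card K ^ 2 * Fintype.card K := by positivity
      apply Nat.eq_of_mul_eq_mul_right h3
      have h4 : ({x : (Fin n → F) × F | (∑ i, c i * x.1 i) + 0 * x.2 = d} ∩
        {x : (Fin n → F) × F | D x.2 = ∑ i, l (x.1 i) ^ 2}) = {x : (Fin n → F) × F | ∑ i, c i * x.1 i = d ∧ D x.2 = ∑ i, l (x.1 i) ^ 2} := by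
        ext x; simp
      rw [h4, this, hn]; ring
    · have := core_count hK hcard l p hp n k hn (fun i => - D ∘ₗ (LinearMap.mulLeft K (c i / c0))) (D (d / c0))
      convert this using 1
      apply Set.ncard_congr (fun x _ => x.1)
      · rintro ⟨x, y⟩ ⟨h1, h2⟩
        simp only [Set.mem_ofPred_eq] at h1 h2 ⊢
        have : y = d / c0 - ∑ i, c i / c0 * x i := by
          rw [← h1, add_div, Finset.sum_div, mul_div_cancel_left₀ _ h0]
          simp only [div_mul_eq_mul_div]
          ring
        rw [← h2, this]
        simp [sub_eq_add_neg]
      · rintro ⟨x, y⟩ ⟨x', y'⟩ ⟨h1, h2⟩ ⟨h1', h2'⟩ h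
        simp only [Set.mem_ofPred_eq] at h1 h1' h
        subst h
        rw [← h1'] at h1
        have := mul_left_cancel₀ h0 (add_left_cancel h1)
        rw [this]
      · intro x hx
        simp only [Set.mem_ofPred_eq] at hx
        refine ⟨(x, d / c0 - ∑ i, c i / c0 * x i), ⟨?_, ?_⟩, rfl⟩
        · simp only [Set.mem_ofPred_eq, div_mul_eq_mul_div, ← Finset.sum_div]
          field_simp
          ring
        · simp only [Set.mem_ofPred_eq]
          rw [hx]
          simp [sub_eq_add_neg]
end

section
variable {F : Type*} [Field F]

/-- The subfield fixed by the `q`-power map `φ`. -/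
def fixK (φ : F →+* F) : Subfield F := RingHom.eqLocusField φ (RingHom.id F)

theorem mem_fixK (φ : F →+* F) (x : F) : x ∈ fixK φ ↔ φ x = x := Iff.rfl

/-- A `K`-linear functional `F → K` built from `x ↦ α x + β φ(x)`. -/
def mkFun (φ : F →+* F) (α β : F) (h : ∀ x, φ (α * x + β * φ x) = α * x + β * φ x) :
    F →ₗ[fixK φ] fixK φ where
  toFun x := ⟨α * x + β * φ x, (mem_fixK φ _).2 (h x)⟩
  map_add' x y := by
    apply Subtype.ext
    simp only [map_add, AddMemClass.mk_add_mk]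
    ring
  map_smul' t x := by
    apply Subtype.ext
    have ht : φ (t : F) = t := (mem_fixK φ _).1 t.2
    simp only [Subfield.smul_def, smul_eq_mul, map_mul, ht, RingHom.id_apply, MulMemClass.mk_mul_mk,
      Subfield.coe_mul]
    ring

theorem mkFun_coe (φ : F →+* F) (α β : F) (h) (x : F) :
    ((mkFun φ α β h x : fixK φ) : F) = α * x + β * φ x := rfl

end

/-- for `q` odd, `r ≥ 2` even and `4a^{q+1} + (b^q − b)² = 0`, the set
`B(a,b)` has `q^{2r−1}` points and its characters with respect to affine hyperplanes
are among `q^{2r−3} − q^{(3r−4)/2}`, `q^{2r−3}`, `q^{2r−3} + q^{(3r−4)/2}`. -/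
theorem statement5 (q r : ℕ) (hq : IsPrimePow q) (hqodd : Odd q)
    (hr : 2 ≤ r) (hreven : Even r)
    {F : Type*} [Field F] [Fintype F] (hF : Fintype.card F = q ^ 2)
    (a b : F) (ha : a ≠ 0) (hb : b ^ q ≠ b)
    (hab : 4 * a ^ (q + 1) + (b ^ q - b) ^ 2 = 0) :
    (BSet q r a b).ncard = q ^ (2 * r - 1) ∧
    ∀ (c : Fin (r - 1) → F) (c0 d : F), ¬(c = 0 ∧ c0 = 0) →
      (({x : (Fin (r - 1) → F) × F | (∑ i, c i * x.1 i) + c0 * x.2 = d}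
          ∩ BSet q r a b)).ncard ∈
        ({q ^ (2 * r - 3) - q ^ ((3 * r - 4) / 2), q ^ (2 * r - 3),
          q ^ (2 * r - 3) + q ^ ((3 * r - 4) / 2)} : Set ℕ) := by
  classical
  have hφ : ∃ φ : F →+* F, ∀ x, φ x = x ^ q := by
    obtain ⟨p, k, hp, hk, rfl⟩ := hq
    have : Fact p.Prime := ⟨hp.nat_prime⟩
    have : CharP F p := charP_of_card_eq_prime_pow (f := k * 2) (by rw [hF, pow_mul])
    exact ⟨iterateFrobenius F p k, fun x => iterateFrobenius_def p k x⟩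
  obtain ⟨φ, hφ⟩ := hφ
  have hφφ : ∀ x, φ (φ x) = x := by
    intro x
    rw [hφ, hφ, ← pow_mul, ← sq, ← hF, FiniteField.pow_card]
  have hchar : ringChar F ≠ 2 := by
    intro h
    have := FiniteField.even_card_of_char_two h
    rw [hF] at this
    have h2 : Odd (q ^ 2) := hqodd.pow
    rw [Nat.odd_iff] at h2
    omega
  have h2 : (2 : F) ≠ 0 := Ring.two_ne_zero hchar
  obtain ⟨e, he⟩ : ∃ e, e = φ b - b := ⟨_, rfl⟩
  have hφe : φ e = -e := by rw [he, map_sub, hφφ]; ring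
  have he0 : e ≠ 0 := by rw [he, hφ]; exact sub_ne_zero.2 hb
  have hab' : e ^ 2 = - 4 * (φ a * a) := by
    rw [he, hφ, hφ, ← pow_succ]; linear_combination hab
  have hφa : φ a ≠ 0 := by simpa using ha
  obtain ⟨t, ht⟩ : ∃ t, t = e / (2 * a) := ⟨_, rfl⟩
  have ht1 : 2 * a * t = e := by rw [ht]; field_simp
  have ht2 : a * t ^ 2 = - φ a := by
    have : (4 * a) * (a * t ^ 2) = (4 * a) * (- φ a) := by
      linear_combination (2 * a * t + e) * ht1 + hab'
    exact mul_left_cancel₀ (by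
      have : (4 : F) = 2 * 2 := by norm_num
      rw [this]; simp [h2, ha]) this
  have ht3 : φ t * t = 1 := by
    have h := congrArg φ ht1
    rw [map_mul, map_mul, map_ofNat, hφe] at h
    have : (-4 * (φ a * a)) * (φ t * t) = (-4 * (φ a * a)) * 1 := by
      linear_combination (-2 * a * t) * h + e * ht1 + hab'
    exact mul_left_cancel₀ (by rw [← hab']; simp [he0]) this
  have hw : ∃ p : F, p + t * φ p ≠ 0 := by
    by_contra! h
    have h1 := h 1
    have h3 := h b
    rw [map_one] at h1
    apply he0
    rw [he]
    linear_combination -h3 + φ b * h1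
  obtain ⟨p, hp⟩ := hw
  obtain ⟨w, hwp⟩ : ∃ w, w = p + t * φ p := ⟨_, rfl⟩
  have hw0 : w ≠ 0 := by rw [hwp]; exact hp
  have hφw : t * φ w = w := by
    rw [hwp, map_add, map_mul, hφφ]
    linear_combination p * ht3
  have ht0 : t ≠ 0 := by
    intro h; rw [h] at ht3; simp at ht3
  obtain ⟨κ, hκ⟩ : ∃ κ, κ = a * w ^ 2 := ⟨_, rfl⟩
  have hκ0 : κ ≠ 0 := by rw [hκ]; simp [ha, hw0]
  have hφκ : φ κ = - κ := by
    rw [hκ, map_mul, map_pow]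
    linear_combination (φ w) ^ 2 * ht2 - a * (t * φ w + w) * hφw
  have hφw0 : φ w ≠ 0 := by simpa using hw0
  let l := mkFun φ w⁻¹ (w⁻¹ * t) (by
    intro x
    simp only [map_add, map_mul, map_inv₀, hφφ]
    field_simp
    linear_combination (-φ x - x * φ t) * hφw + x * φ w * ht3)
  let D := mkFun φ (-κ⁻¹) κ⁻¹ (by
    intro x
    simp only [map_add, map_mul, map_neg, map_inv₀, hφφ, hφκ]
    field_simp
    ring)
  have hl : l p = 1 := by
    apply Subtype.ext
    rw [mkFun_coe, Subfield.coe_one]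
    field_simp
    rw [hwp]
  have hD0 : D b ≠ 0 := by
    intro h
    have := congrArg Subtype.val h
    rw [mkFun_coe, Subfield.coe_zero] at this
    field_simp at this
    apply he0; rw [he]; linear_combination this
  have hD : D ((D b)⁻¹ • b) = 1 := by
    rw [map_smul, smul_eq_mul, inv_mul_cancel₀ hD0]
  have hKq : Fintype.card (fixK φ) = q := by
    have := shift_count (X := F) (A := fixK φ) D (fun s x => x + s • ((D b)⁻¹ • b))
      (fun s x y h => add_right_cancel h) (fun s x => by
        rw [map_add, map_smul, hD, smul_eq_mul, mul_one]) 0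
    have h1 : {x | D x = 0} = (fixK φ : Set F) := by
      ext x
      simp only [Set.mem_ofPred_eq, SetLike.mem_coe, mem_fixK]
      rw [← Subtype.coe_inj, mkFun_coe, Subfield.coe_zero]
      constructor
      · intro h; field_simp at h; linear_combination h
      · intro h; rw [h]; ring
    rw [h1, hF] at this
    have h2 : (fixK φ : Set F).ncard = Fintype.card (fixK φ) := by
      rw [← Nat.card_coe_set_eq, ← Nat.card_eq_fintype_card]; rfl
    rw [h2, ← sq] at this
    exact Nat.pow_left_injective (n := 2) (by norm_num) this
  have hKchar : ringChar (fixK φ) ≠ 2 := by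
    intro h
    have := FiniteField.even_card_of_char_two h
    rw [hKq] at this
    rw [Nat.odd_iff] at hqodd
    omega
  have hB : BSet q r a b = {x : (Fin (r - 1) → F) × F | D x.2 = ∑ i, l (x.1 i) ^ 2} := by
    ext ⟨x, y⟩
    simp only [BSet, Set.mem_ofPred_eq]
    rw [← Subtype.coe_inj (a := D y), mkFun_coe]
    have e1 : ((∑ i, l (x i) ^ 2 : fixK φ) : F) = ∑ i, (w⁻¹ * x i + w⁻¹ * t * φ (x i)) ^ 2 := by
      push_cast
      rfl
    have e2 : ∀ i, κ * (w⁻¹ * x i + w⁻¹ * t * φ (x i)) ^ 2 = a * x i ^ 2 + e * x i ^ (q + 1) - φ a * x i ^ (2 * q) := by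
      intro i
      rw [mul_comm 2 q, pow_mul, pow_succ (x i) q, ← hφ, hκ]
      field_simp
      linear_combination (x i * φ (x i)) * ht1 + φ (x i) ^ 2 * ht2
    have e3 : κ * ∑ i, (w⁻¹ * x i + w⁻¹ * t * φ (x i)) ^ 2 = a * ∑ i, x i ^ 2 + e * ∑ i, x i ^ (q + 1) - φ a * ∑ i, x i ^ (2 * q) := by
      rw [Finset.mul_sum, Finset.sum_congr rfl (fun i _ => e2 i), Finset.sum_sub_distrib,
        Finset.sum_add_distrib, Finset.mul_sum, Finset.mul_sum, Finset.mul_sum]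
    have e4 : κ * (-κ⁻¹ * y + κ⁻¹ * φ y) = φ y - y := by field_simp; ring
    rw [e1, ← mul_right_inj' (b := -κ⁻¹ * y + κ⁻¹ * φ y) hκ0, e3, e4, ← hφ y, ← hφ a, ← hφ b, ← he]
    constructor
    · intro h; linear_combination h
    · intro h; linear_combination h
  obtain ⟨k, hk⟩ : ∃ k, r = 2 * k + 2 := by
    obtain ⟨j, hj⟩ := hreven
    exact ⟨j - 1, by omega⟩
  have main := abs_count hKchar (by rw [hF, hKq]) l D p hl _ hD (r - 1) k (by omega)
  rw [hB]
  rw [hKq] at main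
  have x1 : 2 * r - 1 = 4 * k + 3 := by omega
  have x2 : 2 * r - 3 = 4 * k + 1 := by omega
  have x3 : (3 * r - 4) / 2 = 3 * k + 1 := by omega
  rw [x1, x2, x3]
  exact main
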